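/- Let p be prime, n ≥ 1, m ≥ 1, let α, α₁, …, α_m be real numbers with α₁ + ⋯ + α_m = α, let 1 < r, q < ∞, and set q₁ = ⋯ = q_m = mq and r₁ = ⋯ = r_m = mr. Let ψ be a nonnegative measurable function on (ℤ_p^*)^m. If H^{p,m}_ψ is bounded from K̇^{α₁,r₁}_{q₁}(ℚ_p^n) × ⋯ × K̇^{α_m,r_m}_{q_m}(ℚ_p^n) to K̇^{α,r}_q(ℚ_p^n), i.e. there is C < ∞ with ‖H^{p,m}_ψ(f₁,…,f_m)‖_{K̇^{α,r}_q} ≤ C ∏_i ‖f_i‖_{K̇^{α_i,r_i}_{q_i}} for all nonnegative measurable f_i, then A = ∫_{(ℤ_p^*)^m} |t₁|_p^{-(α₁+n/q₁)} ⋯ |t_m|_p^{-(α_m+n/q_m)} ψ(t₁,…,t_m) dt₁⋯dt_m < ∞, and moreover the operator norm of H^{p,m}_ψ between these spaces equals A. -/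

import Mathlib

open MeasureTheory
open scoped ENNReal

noncomputable section

variable (p : ℕ) [Fact p.Prime]

instance padicMeasurableSpace : MeasurableSpace ℚ_[p] := borel _
instance padicBorelSpace : BorelSpace ℚ_[p] := ⟨rfl⟩

/-- The closed unit ball of `ℚ_[p]` as a positive compact set. -/
def padicUnitBall : TopologicalSpace.PositiveCompacts ℚ_[p] where
  carrier := Metric.closedBall 0 1
  isCompact' := isCompact_closedBall 0 1
  interior_nonempty' :=
    ⟨0, mem_interior_iff_mem_nhds.mpr
      (Filter.mem_of_superset (Metric.ball_mem_nhds 0 one_pos) Metric.ball_subset_closedBall)⟩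

/-- Haar measure on `ℚ_[p]` normalized so that `ℤ_p` has measure 1. -/
def padicHaar : Measure ℚ_[p] := Measure.addHaarMeasure (padicUnitBall p)

instance : SigmaFinite (padicHaar p) := by
  unfold padicHaar; infer_instance

/-- Normalized Haar measure on `ℚ_[p]^n` (the product measure), for which the
unit ball has measure 1. -/
def padicHaarPi (n : ℕ) : Measure (Fin n → ℚ_[p]) := Measure.pi fun _ => padicHaar p

/-- `ℤ_p^* = {t : 0 < |t|_p ≤ 1}`. -/
def Zpstar : Set ℚ_[p] := {t | t ≠ 0 ∧ ‖t‖ ≤ 1}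

/-- `(ℤ_p^*)^m`. -/
def ZpstarPi (m : ℕ) : Set (Fin m → ℚ_[p]) := Set.univ.pi fun _ => Zpstar p

/-- The sphere `S_k = {x ∈ ℚ_p^n : |x|_p = p^k}`. -/
def padicSphere (n : ℕ) (k : ℤ) : Set (Fin n → ℚ_[p]) := {x | ‖x‖ = (p : ℝ) ^ k}

/-- `‖f χ_k‖_{L^q}` for a nonnegative (ℝ≥0∞-valued) function. -/
def lqNormSphere (n : ℕ) (q : ℝ) (k : ℤ) (f : (Fin n → ℚ_[p]) → ℝ≥0∞) : ℝ≥0∞ :=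
  (∫⁻ x in padicSphere p n k, f x ^ q ∂ padicHaarPi p n) ^ (1 / q)

/-- The homogeneous p-adic Herz norm `‖f‖_{K̇^{α,r}_q}`. -/
def herzNorm (n : ℕ) (α r q : ℝ) (f : (Fin n → ℚ_[p]) → ℝ≥0∞) : ℝ≥0∞ :=
  (∑' k : ℤ, (p : ℝ≥0∞) ^ ((k : ℝ) * α * r) * lqNormSphere p n q k f ^ r) ^ (1 / r)

/-- The homogeneous p-adic Morrey–Herz norm `‖f‖_{MK̇^{α,λ}_{r,q}}`. -/
def morreyHerzNorm (n : ℕ) (α lam r q : ℝ) (f : (Fin n → ℚ_[p]) → ℝ≥0∞) : ℝ≥0∞ :=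
  ⨆ k₀ : ℤ, (p : ℝ≥0∞) ^ (-(k₀ : ℝ) * lam) *
    (∑' k : {k : ℤ // k ≤ k₀},
      (p : ℝ≥0∞) ^ (((k : ℤ) : ℝ) * α * r) * lqNormSphere p n q (k : ℤ) f ^ r) ^ (1 / r)

/-- The weighted multilinear p-adic Hardy operator `H^{p,m}_ψ`. -/
def multilinearHardy (n m : ℕ) (ψ : (Fin m → ℚ_[p]) → ℝ≥0∞)
    (f : Fin m → (Fin n → ℚ_[p]) → ℝ≥0∞) (x : Fin n → ℚ_[p]) : ℝ≥0∞ :=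
  ∫⁻ t in ZpstarPi p m, (∏ i, f i (t i • x)) * ψ t ∂ padicHaarPi p m

/-- The dual weighted multilinear p-adic Hardy operator `H^{p,m,*}_ψ`. -/
def multilinearHardyDual (n m : ℕ) (ψ : (Fin m → ℚ_[p]) → ℝ≥0∞)
    (f : Fin m → (Fin n → ℚ_[p]) → ℝ≥0∞) (x : Fin n → ℚ_[p]) : ℝ≥0∞ :=
  ∫⁻ t in ZpstarPi p m,
      (∏ i, f i ((((padicNormE (t i) : ℚ)⁻¹ : ℚ_[p])) • x)) *
        (∏ i, ENNReal.ofReal ‖t i‖ ^ (-(n : ℝ))) * ψ t ∂ padicHaarPi p m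


/-- On a σ-finite space a lower integral is the supremum of the finite integrals of measurable
minorants. -/
theorem lintegral_le_of_forall_le_of_lintegral_ne_top {X : Type*} [MeasurableSpace X]
    {μ : Measure X} [SigmaFinite μ] {f : X → ℝ≥0∞} {b : ℝ≥0∞}
    (h : ∀ g : X → ℝ≥0∞, Measurable g → g ≤ f → ∫⁻ x, g x ∂μ ≠ ⊤ → ∫⁻ x, g x ∂μ ≤ b) :
    ∫⁻ x, f x ∂μ ≤ b := by
  by_contra! hb
  rw [lintegral_eq_nnreal] at hb
  obtain ⟨φ, hφ⟩ := lt_iSup_iff.mp hb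
  obtain ⟨hφf, hφb⟩ := lt_iSup_iff.mp hφ
  rw [← SimpleFunc.lintegral_eq_lintegral] at hφb
  obtain ⟨g, hgφ, hg, hbg⟩ := SimpleFunc.exists_lt_lintegral_simpleFunc_of_lt_lintegral hφb
  refine (h (fun x => g x) g.measurable.coe_nnreal_ennreal (fun x => ?_) hg.ne).not_gt hbg
  exact (ENNReal.coe_le_coe.mpr (hgφ x)).trans (hφf x)

/-- **Minkowski's integral inequality** for `ℝ≥0∞`-valued functions. -/
theorem lintegral_rpow_lintegral_le {X T : Type*} [MeasurableSpace X] [MeasurableSpace T]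
    (μ : Measure X) [SigmaFinite μ] (ν : Measure T) [SFinite ν] {F : X → T → ℝ≥0∞}
    (hF : Measurable (Function.uncurry F)) {q : ℝ} (hq : 1 < q) :
    (∫⁻ x, (∫⁻ t, F x t ∂ν) ^ q ∂μ) ^ (1 / q) ≤ ∫⁻ t, (∫⁻ x, F x t ^ q ∂μ) ^ (1 / q) ∂ν := by
  have hq0 : 0 < q := one_pos.trans hq
  have hpq : q.HolderConjugate (q / (q - 1)) := Real.HolderConjugate.conjExponent hq
  have hFt : ∀ t, Measurable fun x => F x t := fun t => hF.comp measurable_prodMk_right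
  have hFx : ∀ x, Measurable fun t => F x t := fun x => hF.comp measurable_prodMk_left
  set B := ∫⁻ t, (∫⁻ x, F x t ^ q ∂μ) ^ (1 / q) ∂ν
  rw [one_div, ENNReal.rpow_inv_le_iff hq0]
  refine lintegral_le_of_forall_le_of_lintegral_ne_top fun g hg hgF hgtop => ?_
  rcases eq_or_ne (∫⁻ x, g x ∂μ) 0 with hg0 | hg0
  · rw [hg0]; exact zero_le
  have hexp : 1 / q + (q - 1) / q = 1 := by field_simp; ring
  have hexp0 : 0 ≤ (q - 1) / q := div_nonneg (by linarith) hq0.le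
  have key : ∫⁻ x, g x ∂μ ≤ B * (∫⁻ x, g x ∂μ) ^ ((q - 1) / q) := by
    calc ∫⁻ x, g x ∂μ = ∫⁻ x, g x ^ (1 / q) * g x ^ ((q - 1) / q) ∂μ := by
          refine lintegral_congr fun x => ?_
          rw [← ENNReal.rpow_add_of_nonneg _ _ (by positivity) hexp0, hexp, ENNReal.rpow_one]
      _ ≤ ∫⁻ x, (∫⁻ t, F x t ∂ν) * g x ^ ((q - 1) / q) ∂μ := by
          refine lintegral_mono fun x => mul_le_mul_left ?_ _
          rw [one_div, ENNReal.rpow_inv_le_iff hq0]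
          exact hgF x
      _ = ∫⁻ x, ∫⁻ t, F x t * g x ^ ((q - 1) / q) ∂ν ∂μ := by
          refine lintegral_congr fun x => ?_
          rw [lintegral_mul_const _ (hFx x)]
      _ = ∫⁻ t, ∫⁻ x, F x t * g x ^ ((q - 1) / q) ∂μ ∂ν := by
          refine lintegral_lintegral_swap (Measurable.aemeasurable ?_)
          exact hF.mul ((hg.comp measurable_fst).pow_const _)
      _ ≤ ∫⁻ t, (∫⁻ x, F x t ^ q ∂μ) ^ (1 / q) * (∫⁻ x, g x ∂μ) ^ ((q - 1) / q) ∂ν := by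
          refine lintegral_mono fun t => ?_
          have := ENNReal.lintegral_mul_le_Lp_mul_Lq μ hpq (hFt t).aemeasurable
            (hg.pow_const ((q - 1) / q)).aemeasurable
          refine this.trans_eq ?_
          congr 1
          rw [one_div_div]
          congr 1
          refine lintegral_congr fun x => ?_
          rw [← ENNReal.rpow_mul, div_mul_div_cancel₀ hq0.ne', div_self (by linarith),
            ENNReal.rpow_one]
      _ = B * (∫⁻ x, g x ∂μ) ^ ((q - 1) / q) := by
          rw [lintegral_mul_const]
          exact Measurable.pow_const
            (Measurable.lintegral_prod_left' (f := fun z => Function.uncurry F z ^ q)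
              (hF.pow_const q)) _
  have hI0 : (∫⁻ x, g x ∂μ) ^ ((q - 1) / q) ≠ 0 :=
    (ENNReal.rpow_pos (pos_iff_ne_zero.mpr hg0) hgtop).ne'
  have hI1 : (∫⁻ x, g x ∂μ) ^ ((q - 1) / q) ≠ ⊤ := ENNReal.rpow_ne_top_of_nonneg hexp0 hgtop
  rw [← ENNReal.rpow_inv_le_iff hq0, ← ENNReal.mul_le_mul_iff_left hI0 hI1]
  refine le_of_eq_of_le ?_ key
  rw [← one_div, ← ENNReal.rpow_add_of_nonneg _ _ (by positivity) hexp0, hexp, ENNReal.rpow_one]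

/-- Hölder's inequality for `m` functions with equal exponents. -/
theorem lintegral_prod_rpow_le {X : Type*} [MeasurableSpace X] (μ : Measure X) {m : ℕ}
    (hm : 1 ≤ m) {f : Fin m → X → ℝ≥0∞} (hf : ∀ i, Measurable (f i)) {q : ℝ} (hq : 0 < q) :
    (∫⁻ x, (∏ i, f i x) ^ q ∂μ) ^ (1 / q)
      ≤ ∏ i, (∫⁻ x, f i x ^ ((m : ℝ) * q) ∂μ) ^ (1 / ((m : ℝ) * q)) := by
  have hm0 : (0 : ℝ) < m := by exact_mod_cast hm
  have h := ENNReal.lintegral_prod_norm_pow_le (μ := μ) Finset.univ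
    (f := fun i x => f i x ^ ((m : ℝ) * q)) (fun i _ => ((hf i).pow_const _).aemeasurable)
    (p := fun _ => 1 / (m : ℝ)) (by simp [hm0.ne']) (fun i _ => by positivity)
  have h' := ENNReal.rpow_le_rpow h (z := 1 / q) (by positivity)
  rw [← ENNReal.prod_rpow_of_nonneg (by positivity)] at h'
  simp_rw [← ENNReal.rpow_mul] at h'
  convert h' using 4 with x
  · rw [← ENNReal.prod_rpow_of_nonneg hq.le]
    refine Finset.prod_congr rfl fun i _ => ?_
    congr 1; field_simp
  · field_simp

section Scaling

variable {p : ℕ} [Fact p.Prime]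

instance padicHaar_isAddHaarMeasure : (padicHaar p).IsAddHaarMeasure := by
  unfold padicHaar; infer_instance

theorem padicHaar_closedBall_zero_one : padicHaar p (Metric.closedBall 0 1) = 1 :=
  Measure.addHaarMeasure_self (K₀ := padicUnitBall p)

theorem measurable_const_mul_padic (t : ℚ_[p]) : Measurable fun x : ℚ_[p] => t * x :=
  (continuous_const_mul t).measurable

/-- The modulus of multiplication by `t`, as the measure of the preimage of the unit ball. -/
theorem map_mul_padicHaar {t : ℚ_[p]} (ht : t ≠ 0) :
    (padicHaar p).map (fun x => t * x) =
      padicHaar p ((fun x => t * x) ⁻¹' Metric.closedBall 0 1) • padicHaar p := by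
  have : ((padicHaar p).map (fun x => t * x)).IsAddHaarMeasure :=
    (AddAut.mulLeft (Units.mk0 t ht)).isAddHaarMeasure_map _ (continuous_const_mul t)
      (continuous_const_mul t⁻¹)
  conv_lhs => rw [Measure.addHaarMeasure_unique ((padicHaar p).map (fun x => t * x))
    (padicUnitBall p)]
  congr 1
  exact Measure.map_apply (measurable_const_mul_padic t) Metric.isClosed_closedBall.measurableSet

theorem padicHaar_preimage_mul_mul {s t : ℚ_[p]} (hs : s ≠ 0) :
    padicHaar p ((fun x => t * s * x) ⁻¹' Metric.closedBall 0 1) =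
      padicHaar p ((fun x => s * x) ⁻¹' Metric.closedBall 0 1) *
        padicHaar p ((fun x => t * x) ⁻¹' Metric.closedBall 0 1) := by
  have h := congrArg (fun μ => μ ((fun x => t * x) ⁻¹' Metric.closedBall 0 1))
    (map_mul_padicHaar hs)
  simp only [Measure.smul_apply, smul_eq_mul] at h
  rw [← h, Measure.map_apply (measurable_const_mul_padic s)
    (measurable_const_mul_padic t Metric.isClosed_closedBall.measurableSet)]
  congr 1
  ext x
  simp [mul_assoc]

theorem padicHaar_preimage_prime_mul :
    padicHaar p ((fun x => (p : ℚ_[p]) * x) ⁻¹' Metric.closedBall 0 1) = p := by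
  have hp0 : (p : ℚ_[p]) ≠ 0 := by exact_mod_cast (Fact.out : p.Prime).ne_zero
  have hpn : ‖(p : ℚ_[p])‖ = (p : ℝ)⁻¹ := Padic.norm_p
  have hpR : (0 : ℝ) < p := by exact_mod_cast (Fact.out : p.Prime).pos
  have hball : ∀ (x : ℚ_[p]) (y : ℤ_[p]) (_ : (y : ℚ_[p]) = p * x) (j : ℕ),
      x ∈ (fun x => -((j : ℚ_[p]) / p) + x) ⁻¹' Metric.closedBall 0 1 ↔
        y - (j : ℤ_[p]) ∈ IsLocalRing.maximalIdeal ℤ_[p] := by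
    intro x y hy j
    have hx : -((j : ℚ_[p]) / p) + x = (p : ℚ_[p])⁻¹ * (p * x - j) := by field_simp; ring
    have h1 := PadicInt.norm_le_pow_iff_mem_span_pow (y - (j : ℤ_[p])) 1
    rw [pow_one, ← PadicInt.maximalIdeal_eq_span_p] at h1
    rw [← h1, Set.mem_preimage, mem_closedBall_zero_iff, hx, norm_mul, norm_inv, hpn, inv_inv,
      mul_comm, ← le_div_iff₀ hpR]
    simp [PadicInt.norm_def, hy]
  have hsub : ∀ (x : ℚ_[p]) (j : ℕ),
      x ∈ (fun x => -((j : ℚ_[p]) / p) + x) ⁻¹' Metric.closedBall 0 1 →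
        ‖(p : ℚ_[p]) * x‖ ≤ 1 := by
    intro x j hj
    rw [Set.mem_preimage, mem_closedBall_zero_iff] at hj
    have hx : (p : ℚ_[p]) * x = p * (-((j : ℚ_[p]) / p) + x) + j := by field_simp; ring
    rw [hx]
    refine (Padic.nonarchimedean _ _).trans (max_le ?_ ?_)
    · rw [norm_mul]
      exact mul_le_one₀ (Padic.norm_p_lt_one).le (norm_nonneg _) hj
    · simpa using Padic.norm_int_le_one (p := p) j
  have hU : (fun x => (p : ℚ_[p]) * x) ⁻¹' Metric.closedBall 0 1 =
      ⋃ j ∈ Finset.range p, (fun x => -((j : ℚ_[p]) / p) + x) ⁻¹' Metric.closedBall 0 1 := by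
    ext x
    rw [Set.mem_preimage, mem_closedBall_zero_iff]
    simp only [Set.mem_iUnion, Finset.mem_range, exists_prop]
    constructor
    · intro h
      obtain ⟨j, ⟨hj, hjx⟩, -⟩ := PadicInt.existsUnique_mem_range (⟨p * x, h⟩ : ℤ_[p])
      exact ⟨j, hj, (hball x _ rfl j).mpr hjx⟩
    · rintro ⟨j, -, hj⟩
      exact hsub x j hj
  rw [hU, measure_biUnion_finset]
  · simp_rw [measure_preimage_add, padicHaar_closedBall_zero_one]
    simp
  · intro i hi j hj hij
    refine Set.disjoint_left.mpr fun x hxi hxj => hij ?_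
    have h := hsub x i hxi
    exact (PadicInt.existsUnique_mem_range (⟨p * x, h⟩ : ℤ_[p])).unique
      ⟨by simpa using hi, (hball x _ rfl i).mp hxi⟩ ⟨by simpa using hj, (hball x _ rfl j).mp hxj⟩
  · intro j _
    exact (measurable_const_add _) Metric.isClosed_closedBall.measurableSet

theorem padicHaar_preimage_mul_closedBall {t : ℚ_[p]} (ht : t ≠ 0) :
    padicHaar p ((fun x => t * x) ⁻¹' Metric.closedBall 0 1) = (ENNReal.ofReal ‖t‖)⁻¹ := by
  have hp0 : (p : ℚ_[p]) ≠ 0 := by exact_mod_cast (Fact.out : p.Prime).ne_zero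
  have hpR : (0 : ℝ) < p := by exact_mod_cast (Fact.out : p.Prime).pos
  have hpE : (p : ℝ≥0∞) ≠ 0 := by exact_mod_cast (Fact.out : p.Prime).ne_zero
  set c : ℚ_[p] → ℝ≥0∞ := fun t => padicHaar p ((fun x => t * x) ⁻¹' Metric.closedBall 0 1)
    with hc
  have hunit : ∀ u : ℚ_[p], ‖u‖ = 1 → c u = 1 := by
    intro u hu
    rw [← padicHaar_closedBall_zero_one (p := p)]
    simp only [hc]
    congr 1
    ext x
    simp [hu]
  have hmul : ∀ s t : ℚ_[p], s ≠ 0 → c (t * s) = c s * c t := fun s t hs =>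
    padicHaar_preimage_mul_mul hs
  have hnat : ∀ k : ℕ, c ((p : ℚ_[p]) ^ k) = (p : ℝ≥0∞) ^ k := by
    intro k
    induction k with
    | zero => simpa using hunit 1 (by simp)
    | succ k ih =>
      rw [pow_succ, hmul _ _ hp0, ih, pow_succ, mul_comm]
      congr 1
      exact padicHaar_preimage_prime_mul
  have hnorm : ‖t‖ = (p : ℝ) ^ (-t.valuation) := Padic.norm_eq_zpow_neg_valuation ht
  have hofReal : ∀ k : ℕ, ENNReal.ofReal ((p : ℝ) ^ k) = (p : ℝ≥0∞) ^ k := fun k => by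
    rw [ENNReal.ofReal_pow hpR.le, ENNReal.ofReal_natCast]
  change c t = _
  rcases Int.eq_nat_or_neg t.valuation with ⟨k, hk | hk⟩
  · have hpk : ((p : ℚ_[p]) ^ k) ≠ 0 := pow_ne_zero _ hp0
    have h1 : ‖t / (p : ℚ_[p]) ^ k‖ = 1 := by
      rw [norm_div, hnorm, hk, norm_pow, Padic.norm_p]
      field_simp
      simp
    have h2 := hmul _ (t / (p : ℚ_[p]) ^ k) hpk
    rw [div_mul_cancel₀ _ hpk, hunit _ h1, hnat, mul_one] at h2
    rw [h2, hnorm, hk, zpow_neg, zpow_natCast, ENNReal.ofReal_inv_of_pos (by positivity), hofReal,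
      inv_inv]
  · have hpk : ((p : ℚ_[p]) ^ k) ≠ 0 := pow_ne_zero _ hp0
    have h1 : ‖t * (p : ℚ_[p]) ^ k‖ = 1 := by
      rw [norm_mul, hnorm, hk, norm_pow, Padic.norm_p]
      simp [hpR.ne']
    have h2 := hmul _ t hpk
    rw [hunit _ h1, hnat] at h2
    rw [hnorm, hk, neg_neg, zpow_natCast, hofReal]
    exact ENNReal.eq_inv_of_mul_eq_one_left (by rw [mul_comm]; exact h2.symm)

theorem map_smul_padicHaarPi {n : ℕ} {t : ℚ_[p]} (ht : t ≠ 0) :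
    (padicHaarPi p n).map (fun x => t • x) =
      ENNReal.ofReal ‖t‖ ^ (-(n : ℝ)) • padicHaarPi p n := by
  have h1 := map_mul_padicHaar (p := p) ht
  rw [padicHaar_preimage_mul_closedBall ht] at h1
  have : SigmaFinite ((padicHaar p).map fun x => t * x) :=
    (Homeomorph.mulLeft₀ t ht).toMeasurableEquiv.sigmaFinite_map
  have hmap := Measure.pi_map_pi (μ := fun _ : Fin n => padicHaar p)
    (f := fun (_ : Fin n) (x : ℚ_[p]) => t * x)
    (fun _ => (measurable_const_mul_padic t).aemeasurable)
  refine Eq.trans hmap ?_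
  refine Measure.pi_eq fun s hs => ?_
  rw [Measure.smul_apply, padicHaarPi, Measure.pi_pi, h1]
  simp only [Measure.smul_apply, smul_eq_mul, Finset.prod_mul_distrib, Finset.prod_const,
    Finset.card_univ, Fintype.card_fin]
  rw [ENNReal.rpow_neg, ENNReal.rpow_natCast, ENNReal.inv_pow]

theorem ofReal_norm_padic_ne_zero {t : ℚ_[p]} (ht : t ≠ 0) : ENNReal.ofReal ‖t‖ ≠ 0 := by
  simpa using ht

theorem lintegral_comp_smul {n : ℕ} {t : ℚ_[p]} (ht : t ≠ 0) {f : (Fin n → ℚ_[p]) → ℝ≥0∞}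
    (hf : Measurable f) :
    ∫⁻ x, f (t • x) ∂padicHaarPi p n =
      ENNReal.ofReal ‖t‖ ^ (-(n : ℝ)) * ∫⁻ x, f x ∂padicHaarPi p n := by
  rw [← lintegral_map hf (measurable_const_smul t), map_smul_padicHaarPi ht, lintegral_smul_measure,
    smul_eq_mul]

end Scaling

section Herz

variable {p : ℕ} [Fact p.Prime] {n : ℕ}

instance padicHaarPi_sigmaFinite : SigmaFinite (padicHaarPi p n) := by
  unfold padicHaarPi; infer_instance

theorem natCast_prime_ne_zero : (p : ℝ≥0∞) ≠ 0 := by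
  exact_mod_cast (Fact.out : p.Prime).ne_zero

theorem ennreal_rpow_sum {ι : Type*} {x : ℝ≥0∞} (hx0 : x ≠ 0) (hx : x ≠ ⊤) (s : Finset ι)
    (f : ι → ℝ) : x ^ (∑ i ∈ s, f i) = ∏ i ∈ s, x ^ f i := by
  classical
  induction s using Finset.induction with
  | empty => simp
  | insert i s hi ih =>
    rw [Finset.sum_insert hi, Finset.prod_insert hi, ENNReal.rpow_add _ _ hx0 hx, ih]

theorem measurableSet_padicSphere (k : ℤ) : MeasurableSet (padicSphere p n k) :=
  (isClosed_eq continuous_norm continuous_const).measurableSet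

theorem ofReal_zpow_prime (k : ℤ) :
    ENNReal.ofReal ((p : ℝ) ^ k) = (p : ℝ≥0∞) ^ (k : ℝ) := by
  have hpR : (0 : ℝ) < p := by exact_mod_cast (Fact.out : p.Prime).pos
  rw [← Real.rpow_intCast, ← ENNReal.ofReal_rpow_of_pos hpR, ENNReal.ofReal_natCast]

theorem ofReal_norm_padic {t : ℚ_[p]} (ht : t ≠ 0) :
    ENNReal.ofReal ‖t‖ = (p : ℝ≥0∞) ^ ((-t.valuation : ℤ) : ℝ) := by
  rw [Padic.norm_eq_zpow_neg_valuation ht, ofReal_zpow_prime]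

theorem smul_mem_padicSphere {t : ℚ_[p]} (ht : t ≠ 0) (k : ℤ) (x : Fin n → ℚ_[p]) :
    t • x ∈ padicSphere p n (k + -t.valuation) ↔ x ∈ padicSphere p n k := by
  have hpR : (p : ℝ) ≠ 0 := by exact_mod_cast (Fact.out : p.Prime).ne_zero
  simp only [padicSphere, Set.mem_ofPred_eq]
  rw [norm_smul, Padic.norm_eq_zpow_neg_valuation ht, zpow_add₀ hpR, mul_comm,
    mul_left_inj' (zpow_ne_zero _ hpR)]

theorem setLIntegral_padicSphere_comp_smul {t : ℚ_[p]} (ht : t ≠ 0) (k : ℤ)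
    {f : (Fin n → ℚ_[p]) → ℝ≥0∞} (hf : Measurable f) :
    ∫⁻ x in padicSphere p n k, f (t • x) ∂padicHaarPi p n =
      ENNReal.ofReal ‖t‖ ^ (-(n : ℝ)) *
        ∫⁻ x in padicSphere p n (k + -t.valuation), f x ∂padicHaarPi p n := by
  rw [← lintegral_indicator (measurableSet_padicSphere _),
    ← lintegral_indicator (measurableSet_padicSphere _),
    ← lintegral_comp_smul ht (hf.indicator (measurableSet_padicSphere _))]
  refine lintegral_congr fun x => ?_
  by_cases hx : x ∈ padicSphere p n k
  · rw [Set.indicator_of_mem hx, Set.indicator_of_mem ((smul_mem_padicSphere ht k x).mpr hx)]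
  · rw [Set.indicator_of_notMem hx,
      Set.indicator_of_notMem (mt (smul_mem_padicSphere ht k x).mp hx)]

theorem lqNormSphere_comp_smul {t : ℚ_[p]} (ht : t ≠ 0) (k : ℤ) {q : ℝ} (hq : 0 < q)
    {f : (Fin n → ℚ_[p]) → ℝ≥0∞} (hf : Measurable f) :
    lqNormSphere p n q k (fun x => f (t • x)) =
      ENNReal.ofReal ‖t‖ ^ (-((n : ℝ) / q)) * lqNormSphere p n q (k + -t.valuation) f := by
  unfold lqNormSphere
  rw [setLIntegral_padicSphere_comp_smul (f := fun x => f x ^ q) ht k (hf.pow_const q),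
    ENNReal.mul_rpow_of_nonneg _ _ (by positivity), ← ENNReal.rpow_mul]
  congr 2
  ring

theorem herzNorm_eq (α q : ℝ) {r : ℝ} (hr : 0 < r) (f : (Fin n → ℚ_[p]) → ℝ≥0∞) :
    herzNorm p n α r q f =
      (∑' k : ℤ, ((p : ℝ≥0∞) ^ ((k : ℝ) * α) * lqNormSphere p n q k f) ^ r) ^ (1 / r) := by
  unfold herzNorm
  congr 2
  ext k
  rw [ENNReal.mul_rpow_of_nonneg _ _ hr.le, ← ENNReal.rpow_mul]

theorem herzNorm_comp_smul {t : ℚ_[p]} (ht : t ≠ 0) (α : ℝ) {r q : ℝ} (hr : 0 < r) (hq : 0 < q)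
    {f : (Fin n → ℚ_[p]) → ℝ≥0∞} (hf : Measurable f) :
    herzNorm p n α r q (fun x => f (t • x)) =
      ENNReal.ofReal ‖t‖ ^ (-(α + (n : ℝ) / q)) * herzNorm p n α r q f := by
  rw [herzNorm_eq _ _ hr, herzNorm_eq _ _ hr, ← (Equiv.addRight (-t.valuation)).tsum_eq
    (fun k : ℤ => ((p : ℝ≥0∞) ^ ((k : ℝ) * α) * lqNormSphere p n q k f) ^ r)]
  have hc : ∀ c S : ℝ≥0∞, c * S ^ (1 / r) = (c ^ r * S) ^ (1 / r) := fun c S => by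
    rw [ENNReal.mul_rpow_of_nonneg _ _ (by positivity), ← ENNReal.rpow_mul,
      mul_one_div_cancel hr.ne', ENNReal.rpow_one]
  rw [hc, ← ENNReal.tsum_mul_left]
  congr 2
  ext k
  rw [← ENNReal.mul_rpow_of_nonneg _ _ hr.le, lqNormSphere_comp_smul ht k hq hf, ← mul_assoc,
    ← mul_assoc, Equiv.coe_addRight, ofReal_norm_padic ht, ← ENNReal.rpow_mul, ← ENNReal.rpow_mul,
    ← ENNReal.rpow_add _ _ natCast_prime_ne_zero (ENNReal.natCast_ne_top p),
    ← ENNReal.rpow_add _ _ natCast_prime_ne_zero (ENNReal.natCast_ne_top p)]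
  congr 3
  push_cast
  ring

theorem herzNorm_mono (α : ℝ) {r q : ℝ} (hr : 0 < r) (hq : 0 < q)
    {f g : (Fin n → ℚ_[p]) → ℝ≥0∞} (h : f ≤ g) :
    herzNorm p n α r q f ≤ herzNorm p n α r q g := by
  unfold herzNorm lqNormSphere
  gcongr with k
  exact h _

theorem herzNorm_const_mul (α : ℝ) {r q : ℝ} (hr : 0 < r) (hq : 0 < q) (c : ℝ≥0∞)
    {f : (Fin n → ℚ_[p]) → ℝ≥0∞} (hf : Measurable f) :
    herzNorm p n α r q (fun x => c * f x) = c * herzNorm p n α r q f := by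
  have hN : ∀ k, lqNormSphere p n q k (fun x => c * f x) = c * lqNormSphere p n q k f := by
    intro k
    unfold lqNormSphere
    simp_rw [ENNReal.mul_rpow_of_nonneg _ _ hq.le]
    rw [lintegral_const_mul _ (hf.pow_const q), ENNReal.mul_rpow_of_nonneg _ _ (by positivity),
      ← ENNReal.rpow_mul, mul_one_div_cancel hq.ne', ENNReal.rpow_one]
  simp_rw [herzNorm_eq _ _ hr, hN, mul_left_comm _ c, ENNReal.mul_rpow_of_nonneg c _ hr.le,
    ENNReal.tsum_mul_left]
  rw [ENNReal.mul_rpow_of_nonneg _ _ (by positivity),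
      ← ENNReal.rpow_mul, mul_one_div_cancel hr.ne', ENNReal.rpow_one]

theorem measurable_lqNormSphere {T : Type*} [MeasurableSpace T] (q : ℝ) (k : ℤ)
    {F : (Fin n → ℚ_[p]) → T → ℝ≥0∞} (hF : Measurable (Function.uncurry F)) :
    Measurable fun t => lqNormSphere p n q k fun x => F x t := by
  unfold lqNormSphere
  exact Measurable.pow_const (Measurable.lintegral_prod_left'
    (f := fun z => Function.uncurry F z ^ q) (hF.pow_const q)) _

/-- Minkowski's integral inequality for Herz norms. -/
theorem herzNorm_lintegral_le {T : Type*} [MeasurableSpace T] (ν : Measure T) [SFinite ν]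
    (α : ℝ) {r q : ℝ} (hr : 1 < r) (hq : 1 < q)
    {F : (Fin n → ℚ_[p]) → T → ℝ≥0∞} (hF : Measurable (Function.uncurry F)) :
    herzNorm p n α r q (fun x => ∫⁻ t, F x t ∂ν) ≤
      ∫⁻ t, herzNorm p n α r q (fun x => F x t) ∂ν := by
  have hr0 : 0 < r := one_pos.trans hr
  have hmeas := fun k : ℤ =>
    (measurable_lqNormSphere q k hF).const_mul ((p : ℝ≥0∞) ^ ((k : ℝ) * α))
  have h := lintegral_rpow_lintegral_le (Measure.count : Measure ℤ) ν
    (F := fun k t => (p : ℝ≥0∞) ^ ((k : ℝ) * α) * lqNormSphere p n q k fun x => F x t)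
    (measurable_from_prod_countable_right hmeas) hr
  simp only [lintegral_count] at h
  simp_rw [herzNorm_eq _ _ hr0]
  refine le_trans ?_ h
  gcongr with k
  rw [lintegral_const_mul _ (measurable_lqNormSphere q k hF)]
  gcongr
  exact lintegral_rpow_lintegral_le _ ν hF hq

/-- Hölder's inequality for Herz norms. -/
theorem herzNorm_prod_le {m : ℕ} (hm : 1 ≤ m) (αi : Fin m → ℝ) {r q : ℝ} (hr : 0 < r) (hq : 0 < q)
    {f : Fin m → (Fin n → ℚ_[p]) → ℝ≥0∞} (hf : ∀ i, Measurable (f i)) :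
    herzNorm p n (∑ i, αi i) r q (fun x => ∏ i, f i x) ≤
      ∏ i, herzNorm p n (αi i) ((m : ℝ) * r) ((m : ℝ) * q) (f i) := by
  have hm0 : (0 : ℝ) < m := by exact_mod_cast hm
  have h := lintegral_prod_rpow_le (Measure.count : Measure ℤ) hm
    (f := fun i k => (p : ℝ≥0∞) ^ ((k : ℝ) * αi i) * lqNormSphere p n ((m : ℝ) * q) k (f i))
    (fun i => measurable_of_countable _) hr
  simp only [lintegral_count] at h
  simp_rw [herzNorm_eq _ _ (mul_pos hm0 hr)]
  rw [herzNorm_eq _ _ hr]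
  refine le_trans ?_ h
  gcongr with k
  rw [Finset.prod_mul_distrib]
  gcongr
  · rw [Finset.mul_sum, ennreal_rpow_sum natCast_prime_ne_zero (ENNReal.natCast_ne_top p)]
  · exact lintegral_prod_rpow_le _ hm hf hq

end Herz

section Bound

variable {p : ℕ} [Fact p.Prime] {n m : ℕ}

theorem measurableSet_ZpstarPi : MeasurableSet (ZpstarPi p m) := by
  refine MeasurableSet.univ_pi fun _ => ?_
  have : Zpstar p = {0}ᶜ ∩ Metric.closedBall 0 1 := by
    ext t
    simp [Zpstar]
  rw [this]
  exact (measurableSet_singleton 0).compl.inter Metric.isClosed_closedBall.measurableSet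

theorem measurable_smul_apply (i : Fin m) :
    Measurable fun z : (Fin n → ℚ_[p]) × (Fin m → ℚ_[p]) => z.2 i • z.1 :=
  (((continuous_apply i).comp continuous_snd).smul continuous_fst).measurable

theorem herzNorm_multilinearHardy_le (hm : 1 ≤ m) (αi : Fin m → ℝ) {r q : ℝ} (hr : 1 < r)
    (hq : 1 < q) {ψ : (Fin m → ℚ_[p]) → ℝ≥0∞} (hψ : Measurable ψ)
    {f : Fin m → (Fin n → ℚ_[p]) → ℝ≥0∞} (hf : ∀ i, Measurable (f i)) :
    herzNorm p n (∑ i, αi i) r q (multilinearHardy p n m ψ f) ≤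
      (∫⁻ t in ZpstarPi p m,
        (∏ i, ENNReal.ofReal ‖t i‖ ^ (-(αi i + (n : ℝ) / ((m : ℝ) * q)))) * ψ t
          ∂padicHaarPi p m) *
        ∏ i, herzNorm p n (αi i) ((m : ℝ) * r) ((m : ℝ) * q) (f i) := by
  have hm0 : (0 : ℝ) < m := by exact_mod_cast hm
  have hr0 : 0 < r := one_pos.trans hr
  have hq0 : 0 < q := one_pos.trans hq
  have hfs : ∀ (i : Fin m) (c : ℚ_[p]), Measurable fun x => f i (c • x) := fun i c =>
    (hf i).comp (measurable_const_smul c)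
  unfold multilinearHardy
  refine (herzNorm_lintegral_le _ _ hr hq ?_).trans ?_
  · exact (Finset.measurable_prod _ fun i _ => (hf i).comp (measurable_smul_apply i)).mul
      (hψ.comp measurable_snd)
  rw [← lintegral_mul_const]
  · refine setLIntegral_mono' measurableSet_ZpstarPi fun t ht => ?_
    have ht0 : ∀ i, t i ≠ 0 := fun i => (ht i (Set.mem_univ i)).1
    simp_rw [mul_comm _ (ψ t)]
    rw [herzNorm_const_mul _ hr0 hq0 _ (Finset.measurable_prod _ fun i _ => hfs i (t i)), mul_assoc]
    gcongr
    refine (herzNorm_prod_le hm αi hr0 hq0 fun i => hfs i (t i)).trans_eq ?_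
    rw [← Finset.prod_mul_distrib]
    refine Finset.prod_congr rfl fun i _ => ?_
    exact herzNorm_comp_smul (ht0 i) _ (mul_pos hm0 hr0) (mul_pos hm0 hq0) (hf i)
  · refine (Finset.measurable_prod _ fun i _ => ?_).mul hψ
    exact ((measurable_pi_apply i).norm.ennreal_ofReal).pow_const _

end Bound

section Sharpness

variable {p : ℕ} [Fact p.Prime] {n m : ℕ}

/-- The function `|x|^{-β}` truncated to the shell `p^a ≤ |x| ≤ p^b`. -/
def shellPower (p : ℕ) [Fact p.Prime] (n : ℕ) (a b : ℤ) (β : ℝ) : (Fin n → ℚ_[p]) → ℝ≥0∞ :=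
  {x | (p : ℝ) ^ a ≤ ‖x‖ ∧ ‖x‖ ≤ (p : ℝ) ^ b}.indicator fun x => ENNReal.ofReal ‖x‖ ^ (-β)

theorem measurable_shellPower (a b : ℤ) (β : ℝ) : Measurable (shellPower p n a b β) :=
  (measurable_norm.ennreal_ofReal.pow_const _).indicator
    ((isClosed_le continuous_const continuous_norm).inter
      (isClosed_le continuous_norm continuous_const)).measurableSet

theorem padicHaarPi_padicSphere (k : ℤ) :
    padicHaarPi p n (padicSphere p n k) =
      (p : ℝ≥0∞) ^ ((k : ℝ) * n) * padicHaarPi p n (padicSphere p n 0) := by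
  have hp0 : (p : ℚ_[p]) ≠ 0 := by exact_mod_cast (Fact.out : p.Prime).ne_zero
  have h := setLIntegral_padicSphere_comp_smul (p := p) (n := n) (zpow_ne_zero k hp0) k
    (f := fun _ => 1) measurable_const
  simp only [lintegral_const, one_mul, Measure.restrict_apply_univ, Padic.valuation_zpow,
    Padic.valuation_p, mul_one, add_neg_cancel] at h
  rw [h, ofReal_norm_padic (zpow_ne_zero k hp0), ← ENNReal.rpow_mul]
  simp

theorem padicHaarPi_padicSphere_zero_ne_zero (hn : 1 ≤ n) :
    padicHaarPi p n (padicSphere p n 0) ≠ 0 := by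
  have hopen : IsOpen (padicSphere p n 0) := by
    have : padicSphere p n 0 = Metric.sphere 0 1 := by
      ext x; simp [padicSphere]
    rw [this]
    exact IsUltrametricDist.isOpen_sphere 0 one_ne_zero
  have : (padicHaarPi p n).IsOpenPosMeasure := by unfold padicHaarPi; infer_instance
  have : Nonempty (Fin n) := ⟨⟨0, hn⟩⟩
  refine (hopen.measure_pos _ ⟨fun _ => 1, ?_⟩).ne'
  simp [padicSphere]

theorem padicHaarPi_padicSphere_zero_ne_top : padicHaarPi p n (padicSphere p n 0) ≠ ⊤ := by
  have hc : IsCompact (padicSphere p n 0) := by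
    have : padicSphere p n 0 = Metric.sphere 0 1 := by
      ext x; simp [padicSphere]
    rw [this]
    exact isCompact_sphere 0 1
  have : IsFiniteMeasureOnCompacts (padicHaarPi p n) := by unfold padicHaarPi; infer_instance
  exact hc.measure_lt_top.ne

theorem lqNormSphere_shellPower (a b : ℤ) (α : ℝ) {q : ℝ} (hq : 0 < q) (k : ℤ) :
    (p : ℝ≥0∞) ^ ((k : ℝ) * α) * lqNormSphere p n q k (shellPower p n a b (α + n / q)) =
      if k ∈ Finset.Icc a b then padicHaarPi p n (padicSphere p n 0) ^ (1 / q) else 0 := by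
  have hp1 : (1 : ℝ) < p := by exact_mod_cast (Fact.out : p.Prime).one_lt
  have hmem : ∀ x ∈ padicSphere p n k,
      (x ∈ {x : Fin n → ℚ_[p] | (p : ℝ) ^ a ≤ ‖x‖ ∧ ‖x‖ ≤ (p : ℝ) ^ b} ↔ k ∈ Finset.Icc a b) := by
    intro x hx
    have hx' : ‖x‖ = (p : ℝ) ^ k := hx
    rw [Set.mem_ofPred_eq, hx', zpow_le_zpow_iff_right₀ hp1, zpow_le_zpow_iff_right₀ hp1,
      Finset.mem_Icc]
  unfold lqNormSphere
  split_ifs with hk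
  · have h1 : ∫⁻ x in padicSphere p n k, shellPower p n a b (α + n / q) x ^ q ∂padicHaarPi p n =
        ∫⁻ _ in padicSphere p n k, (p : ℝ≥0∞) ^ (-((k : ℝ) * α * q + k * n)) ∂padicHaarPi p n := by
      refine setLIntegral_congr_fun (measurableSet_padicSphere k) fun x hx => ?_
      have hx' : ‖x‖ = (p : ℝ) ^ k := hx
      change shellPower p n a b (α + n / q) x ^ q = _
      rw [shellPower, Set.indicator_of_mem ((hmem x hx).mpr hk), hx', ofReal_zpow_prime,
        ← ENNReal.rpow_mul, ← ENNReal.rpow_mul]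
      congr 1
      field_simp
    rw [h1, lintegral_const, Measure.restrict_apply_univ, padicHaarPi_padicSphere, ← mul_assoc,
      ← ENNReal.rpow_add _ _ natCast_prime_ne_zero (ENNReal.natCast_ne_top p),
      ENNReal.mul_rpow_of_nonneg _ _ (by positivity), ← mul_assoc, ← ENNReal.rpow_mul,
      ← ENNReal.rpow_add _ _ natCast_prime_ne_zero (ENNReal.natCast_ne_top p)]
    rw [show (k : ℝ) * α + (-((k : ℝ) * α * q + k * n) + k * n) * (1 / q) = 0 by field_simp; ring,
      ENNReal.rpow_zero, one_mul]
  · have h1 : ∫⁻ x in padicSphere p n k, shellPower p n a b (α + n / q) x ^ q ∂padicHaarPi p n =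
        ∫⁻ _ in padicSphere p n k, 0 ∂padicHaarPi p n := by
      refine setLIntegral_congr_fun (measurableSet_padicSphere k) fun x hx => ?_
      rw [shellPower, Set.indicator_of_notMem (mt (hmem x hx).mp hk), ENNReal.zero_rpow_of_pos hq]
    rw [h1, lintegral_zero, ENNReal.zero_rpow_of_pos (by positivity), mul_zero]

theorem herzNorm_shellPower (a b : ℤ) (α : ℝ) {r q : ℝ} (hr : 0 < r) (hq : 0 < q) :
    herzNorm p n α r q (shellPower p n a b (α + n / q)) =
      ((b + 1 - a).toNat : ℝ≥0∞) ^ (1 / r) * padicHaarPi p n (padicSphere p n 0) ^ (1 / q) := by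
  rw [herzNorm_eq _ _ hr]
  simp_rw [lqNormSphere_shellPower a b α hq]
  rw [tsum_eq_sum (s := Finset.Icc a b) fun k hk => by
    rw [if_neg hk, ENNReal.zero_rpow_of_pos hr]]
  rw [Finset.sum_congr rfl fun k hk => by rw [if_pos hk], Finset.sum_const, Int.card_Icc,
    nsmul_eq_mul, ENNReal.mul_rpow_of_nonneg _ _ (by positivity), ← ENNReal.rpow_mul,
    mul_one_div_cancel hr.ne', ENNReal.rpow_one]

/-- The part of `(ℤ_p^*)^m` on which all coordinates satisfy `|t_i| ≥ p^{-L}`. -/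
def ZpstarPiTrunc (p : ℕ) [Fact p.Prime] (m L : ℕ) : Set (Fin m → ℚ_[p]) :=
  ZpstarPi p m ∩ {t | ∀ i, (p : ℝ) ^ (-(L : ℤ)) ≤ ‖t i‖}

theorem measurableSet_ZpstarPiTrunc (L : ℕ) : MeasurableSet (ZpstarPiTrunc p m L) := by
  refine measurableSet_ZpstarPi.inter ?_
  rw [Set.ofPred_forall]
  exact MeasurableSet.iInter fun i =>
    (isClosed_le continuous_const (continuous_apply i).norm).measurableSet

theorem iUnion_ZpstarPiTrunc : ⋃ L, ZpstarPiTrunc p m L = ZpstarPi p m := by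
  have hp1 : (1 : ℝ) < p := by exact_mod_cast (Fact.out : p.Prime).one_lt
  unfold ZpstarPiTrunc
  rw [← Set.inter_iUnion, Set.inter_eq_left]
  intro t ht
  have hL : ∀ i, ∃ L : ℕ, (-(L : ℤ)) ≤ -(t i).valuation := fun i =>
    ⟨(t i).valuation.toNat, by omega⟩
  choose L hL using hL
  refine Set.mem_iUnion.mpr ⟨Finset.univ.sup L, fun i => ?_⟩
  rw [Padic.norm_eq_zpow_neg_valuation (ht i (Set.mem_univ i)).1, zpow_le_zpow_iff_right₀ hp1]
  have : L i ≤ Finset.univ.sup L := Finset.le_sup (Finset.mem_univ i)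
  have := hL i
  omega

theorem monotone_ZpstarPiTrunc : Monotone (ZpstarPiTrunc p m) := by
  have hp1 : (1 : ℝ) ≤ p := by exact_mod_cast (Fact.out : p.Prime).one_lt.le
  refine fun K L hKL => Set.inter_subset_inter_right _ fun t ht i => ?_
  exact (zpow_le_zpow_right₀ hp1 (by omega)).trans (ht i)

theorem shellPower_mul_le_multilinearHardy (αi : Fin m → ℝ) (c : ℝ) (L M : ℕ)
    (ψ : (Fin m → ℚ_[p]) → ℝ≥0∞) (hψ : Measurable ψ) (x : Fin n → ℚ_[p]) :
    (∫⁻ t in ZpstarPiTrunc p m L,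
        (∏ i, ENNReal.ofReal ‖t i‖ ^ (-(αi i + c))) * ψ t ∂padicHaarPi p m) *
      shellPower p n L M (∑ i, (αi i + c)) x ≤
    multilinearHardy p n m ψ (fun i => shellPower p n 0 M (αi i + c)) x := by
  have hpR : (0 : ℝ) < p := by exact_mod_cast (Fact.out : p.Prime).pos
  by_cases hx : x ∈ {x : Fin n → ℚ_[p] | (p : ℝ) ^ (L : ℤ) ≤ ‖x‖ ∧ ‖x‖ ≤ (p : ℝ) ^ (M : ℤ)}
  swap
  · rw [shellPower, Set.indicator_of_notMem hx, mul_zero]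
    exact zero_le
  have hx0 : 0 < ‖x‖ := (zpow_pos hpR _).trans_le hx.1
  rw [shellPower, Set.indicator_of_mem hx, ← lintegral_mul_const]
  · unfold multilinearHardy
    refine le_trans ?_ (lintegral_mono_set
      (Set.inter_subset_left : ZpstarPiTrunc p m L ⊆ ZpstarPi p m))
    refine setLIntegral_mono' (measurableSet_ZpstarPiTrunc L) fun t ht => ?_
    rw [mul_right_comm, ← Finset.sum_neg_distrib,
      ennreal_rpow_sum (by simpa using hx0) ENNReal.ofReal_ne_top, ← Finset.prod_mul_distrib]
    gcongr with i
    have ht1 : ‖t i‖ ≤ 1 := (ht.1 i (Set.mem_univ i)).2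
    have htx : t i • x ∈
        {x : Fin n → ℚ_[p] | (p : ℝ) ^ (0 : ℤ) ≤ ‖x‖ ∧ ‖x‖ ≤ (p : ℝ) ^ (M : ℤ)} := by
      rw [Set.mem_ofPred_eq, norm_smul]
      constructor
      · calc (p : ℝ) ^ (0 : ℤ) = (p : ℝ) ^ (-(L : ℤ)) * (p : ℝ) ^ (L : ℤ) := by
              rw [← zpow_add₀ hpR.ne', neg_add_cancel]
          _ ≤ ‖t i‖ * ‖x‖ := by
              gcongr
              · exact ht.2 i
              · exact hx.1
      · exact (mul_le_of_le_one_left hx0.le ht1).trans hx.2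
    beta_reduce
    rw [shellPower, Set.indicator_of_mem htx, norm_smul, ENNReal.ofReal_mul (norm_nonneg _),
      ENNReal.mul_rpow_of_ne_top ENNReal.ofReal_ne_top ENNReal.ofReal_ne_top]
  · refine (Finset.measurable_prod _ fun i _ => ?_).mul hψ
    exact ((measurable_pi_apply i).norm.ennreal_ofReal).pow_const _

end Sharpness
theorem ennreal_le_of_forall_mul_rpow_le {a c : ℝ≥0∞} {r : ℝ} (hr : 0 < r) (L : ℕ)
    (h : ∀ M : ℕ, a * ((M + 1 : ℕ) : ℝ≥0∞) ^ (1 / r) ≤ c * ((L + M + 1 : ℕ) : ℝ≥0∞) ^ (1 / r)) :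
    a ≤ c := by
  have hle : ∀ M : ℕ, a ≤ c * (1 + (L : ℝ≥0∞) / ((M + 1 : ℕ) : ℝ≥0∞)) ^ (1 / r) := by
    intro M
    have hM0 : ((M + 1 : ℕ) : ℝ≥0∞) ≠ 0 := by exact_mod_cast M.succ_ne_zero
    have hMt : ((M + 1 : ℕ) : ℝ≥0∞) ≠ ⊤ := ENNReal.natCast_ne_top _
    have hr' : 0 ≤ 1 / r := by positivity
    have h0 : ((M + 1 : ℕ) : ℝ≥0∞) ^ (1 / r) ≠ 0 :=
      (ENNReal.rpow_pos (pos_iff_ne_zero.mpr hM0) hMt).ne'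
    have ht : ((M + 1 : ℕ) : ℝ≥0∞) ^ (1 / r) ≠ ⊤ := ENNReal.rpow_ne_top_of_nonneg hr' hMt
    rw [← ENNReal.mul_le_mul_iff_left h0 ht]
    refine (h M).trans_eq ?_
    rw [mul_assoc, ← ENNReal.mul_rpow_of_nonneg _ _ hr', add_mul, one_mul,
      ENNReal.div_mul_cancel hM0 hMt]
    congr 2
    push_cast
    ring
  rcases eq_or_ne c 0 with rfl | hc
  · simpa using hle 0
  refine ge_of_tendsto' (x := Filter.atTop) ?_ hle
  have h1 : Filter.Tendsto (fun M : ℕ => (L : ℝ≥0∞) / ((M + 1 : ℕ) : ℝ≥0∞)) Filter.atTop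
      (nhds 0) := by
    have := ENNReal.Tendsto.const_div (a := (L : ℝ≥0∞))
      (ENNReal.tendsto_nat_nhds_top.comp (Filter.tendsto_add_atTop_nat 1))
      (Or.inr (ENNReal.natCast_ne_top L))
    rwa [ENNReal.div_top] at this
  have h2 := (((tendsto_const_nhds (x := (1 : ℝ≥0∞))).add h1).ennrpow_const (1 / r))
  have h3 := ENNReal.Tendsto.const_mul (a := c) h2 (Or.inl (by simp))
  simpa using h3

theorem lintegral_weight_le {p n m : ℕ} [Fact p.Prime] (hn : 1 ≤ n) (hm : 1 ≤ m)
    (αi : Fin m → ℝ) {r q : ℝ} (hr : 0 < r) (hq : 0 < q)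
    {ψ : (Fin m → ℚ_[p]) → ℝ≥0∞} (hψ : Measurable ψ) {C : ℝ≥0∞}
    (hC : ∀ f : Fin m → (Fin n → ℚ_[p]) → ℝ≥0∞, (∀ i, Measurable (f i)) →
      herzNorm p n (∑ i, αi i) r q (multilinearHardy p n m ψ f)
        ≤ C * ∏ i, herzNorm p n (αi i) ((m : ℝ) * r) ((m : ℝ) * q) (f i)) :
    ∫⁻ t in ZpstarPi p m,
      (∏ i, ENNReal.ofReal ‖t i‖ ^ (-(αi i + (n : ℝ) / ((m : ℝ) * q)))) * ψ t
        ∂padicHaarPi p m ≤ C := by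
  have hm0 : (0 : ℝ) < m := by exact_mod_cast hm
  rw [← iUnion_ZpstarPiTrunc,
    setLIntegral_iUnion_of_directed _ monotone_ZpstarPiTrunc.directed_le]
  refine iSup_le fun L => ennreal_le_of_forall_mul_rpow_le hr L fun M => ?_
  have hsum : ∑ i, (αi i + (n : ℝ) / ((m : ℝ) * q)) = ∑ i, αi i + n / q := by
    rw [Finset.sum_add_distrib, Finset.sum_const, Finset.card_univ, Fintype.card_fin, nsmul_eq_mul]
    congr 1
    field_simp
  set K := padicHaarPi p n (padicSphere p n 0)
  have hK0 : K ^ (1 / q) ≠ 0 := (ENNReal.rpow_pos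
    (pos_iff_ne_zero.mpr (padicHaarPi_padicSphere_zero_ne_zero hn))
    padicHaarPi_padicSphere_zero_ne_top).ne'
  have hKt : K ^ (1 / q) ≠ ⊤ :=
    ENNReal.rpow_ne_top_of_nonneg (by positivity) padicHaarPi_padicSphere_zero_ne_top
  have h := hC (fun i => shellPower p n 0 ((L + M : ℕ) : ℤ) (αi i + (n : ℝ) / ((m : ℝ) * q)))
    fun i => measurable_shellPower _ _ _
  have hlow := (herzNorm_mono (∑ i, αi i) hr hq
    (shellPower_mul_le_multilinearHardy (n := n) αi ((n : ℝ) / ((m : ℝ) * q)) L (L + M) ψ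
      hψ)).trans h
  have hprod : ∀ x : ℝ≥0∞, ∀ s : ℝ, ∏ _i : Fin m, x ^ (1 / ((m : ℝ) * s)) = x ^ (1 / s) := by
    intro x s
    rw [Finset.prod_const, Finset.card_univ, Fintype.card_fin, ← ENNReal.rpow_mul_natCast]
    congr 1
    rw [one_div, mul_inv, mul_right_comm, inv_mul_cancel₀ hm0.ne', one_mul, one_div]
  rw [herzNorm_const_mul _ hr hq _ (measurable_shellPower _ _ _), hsum,
    herzNorm_shellPower _ _ _ hr hq, Finset.prod_congr rfl fun i _ =>
      herzNorm_shellPower 0 _ (αi i) (mul_pos hm0 hr) (mul_pos hm0 hq),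
    Finset.prod_mul_distrib, hprod, hprod, ← mul_assoc, ← mul_assoc,
    ENNReal.mul_le_mul_iff_left hK0 hKt,
    show (((L + M : ℕ) : ℤ) + 1 - (L : ℤ)).toNat = M + 1 by omega,
    show (((L + M : ℕ) : ℤ) + 1 - 0).toNat = L + M + 1 by omega] at hlow
  exact hlow

/-- Necessity part of Theorem 2.1: with `q_i = m q`, `r_i = m r`, boundedness of the
weighted multilinear p-adic Hardy operator on the product of Herz spaces forces the
weight integral `A` to be finite, and the operator norm equals `A`. -/
theorem statement1 (p n m : ℕ) [Fact p.Prime] (hn : 1 ≤ n) (hm : 1 ≤ m)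
    (α : ℝ) (αi : Fin m → ℝ) (r q : ℝ) (hr : 1 < r) (hq : 1 < q)
    (hα : ∑ i, αi i = α)
    (ψ : (Fin m → ℚ_[p]) → ℝ≥0∞) (hψ : Measurable ψ)
    (hbdd : ∃ C : ℝ≥0∞, C ≠ ⊤ ∧
      ∀ f : Fin m → (Fin n → ℚ_[p]) → ℝ≥0∞, (∀ i, Measurable (f i)) →
        herzNorm p n α r q (multilinearHardy p n m ψ f)
          ≤ C * ∏ i, herzNorm p n (αi i) ((m : ℝ) * r) ((m : ℝ) * q) (f i)) :
    (∫⁻ t in ZpstarPi p m,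
        (∏ i, ENNReal.ofReal ‖t i‖ ^ (-(αi i + (n : ℝ) / ((m : ℝ) * q)))) * ψ t
          ∂ padicHaarPi p m) ≠ ⊤ ∧
      sInf {C : ℝ≥0∞ | ∀ f : Fin m → (Fin n → ℚ_[p]) → ℝ≥0∞, (∀ i, Measurable (f i)) →
        herzNorm p n α r q (multilinearHardy p n m ψ f)
          ≤ C * ∏ i, herzNorm p n (αi i) ((m : ℝ) * r) ((m : ℝ) * q) (f i)}
        = ∫⁻ t in ZpstarPi p m,
            (∏ i, ENNReal.ofReal ‖t i‖ ^ (-(αi i + (n : ℝ) / ((m : ℝ) * q)))) * ψ t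
              ∂ padicHaarPi p m := by
  subst hα
  have hle := fun C hC => lintegral_weight_le (C := C) hn hm αi (one_pos.trans hr)
    (one_pos.trans hq) hψ hC
  obtain ⟨C, hCtop, hC⟩ := hbdd
  refine ⟨ne_top_of_le_ne_top hCtop (hle C hC), le_antisymm (sInf_le fun f hf => ?_) ?_⟩
  · exact herzNorm_multilinearHardy_le hm αi hr hq hψ hf
  · exact le_sInf hle

end
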